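/- Let n ≥ 2, and suppose a_1,…,a_N, b_1,…,b_N ∈ ℂⁿ satisfy Σ_{i=1}^N ⟨a_i,b_i⟩ · a_i b_i* = I_n and, for all i ≠ j, ⟨a_i,a_j⟩⟨b_j,b_i⟩ = (1/n)⟨a_i,b_i⟩⟨b_j,a_j⟩. Then for every index i with ⟨a_i,b_i⟩ ≠ 0 one has (1/n)|⟨a_i,b_i⟩|² = ‖a_i‖² ‖b_i‖², provided additionally that Σ_{j=1}^N |⟨a_j,b_j⟩|² = n. -/

import Mathlib

open Matrix BigOperators

noncomputable section

/-- The standard inner product on `ℂⁿ`, conjugate-linear in the first argument. -/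
def cip {n : ℕ} (a b : Fin n → ℂ) : ℂ := star a ⬝ᵥ b

theorem stmt16 (n N : ℕ) (hn : 2 ≤ n) (a b : Fin N → (Fin n → ℂ))
    (hsum : ∑ i, cip (a i) (b i) • Matrix.vecMulVec (a i) (star (b i))
        = (1 : Matrix (Fin n) (Fin n) ℂ))
    (hoff : ∀ i j : Fin N, i ≠ j →
      cip (a i) (a j) * cip (b j) (b i)
        = (1 / (n : ℂ)) * (cip (a i) (b i) * cip (b j) (a j)))
    (hnorm : ∑ j, (starRingEnd ℂ) (cip (a j) (b j)) * cip (a j) (b j) = (n : ℂ)) :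
    ∀ i : Fin N, cip (a i) (b i) ≠ 0 →
      (1 / (n : ℂ)) * ((starRingEnd ℂ) (cip (a i) (b i)) * cip (a i) (b i))
        = cip (a i) (a i) * cip (b i) (b i) := by
  intro k hk
  have hn0 : (n : ℂ) ≠ 0 := by
    have : n ≠ 0 := by omega
    exact_mod_cast this
  have hconj : ∀ j, (starRingEnd ℂ) (cip (a j) (b j)) = cip (b j) (a j) := by
    intro j
    simp only [cip, dotProduct, map_sum, map_mul, Pi.star_apply, RCLike.star_def,
      Complex.conj_conj]
    exact Finset.sum_congr rfl fun x _ => mul_comm _ _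
  have key : ∑ i, cip (a i) (b i) * (cip (a k) (a i) * cip (b i) (b k))
      = cip (a k) (b k) := by
    have h := congrArg (fun M : Matrix (Fin n) (Fin n) ℂ => star (a k) ⬝ᵥ (M *ᵥ b k)) hsum
    simp only [Matrix.sum_mulVec, Matrix.smul_mulVec, Matrix.vecMulVec_mulVec,
      Matrix.one_mulVec, dotProduct_sum, dotProduct_smul] at h
    simpa [cip, mul_comm, mul_left_comm] using h
  have hsplit := Finset.add_sum_erase Finset.univ
    (fun i => cip (a i) (b i) * (cip (a k) (a i) * cip (b i) (b k))) (Finset.mem_univ k)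
  have hsplit2 := Finset.add_sum_erase Finset.univ
    (fun j => (starRingEnd ℂ) (cip (a j) (b j)) * cip (a j) (b j)) (Finset.mem_univ k)
  have hrest : ∑ i ∈ Finset.univ.erase k,
      cip (a i) (b i) * (cip (a k) (a i) * cip (b i) (b k))
      = (1 / (n : ℂ)) * cip (a k) (b k) * ∑ j ∈ Finset.univ.erase k,
        (starRingEnd ℂ) (cip (a j) (b j)) * cip (a j) (b j) := by
    rw [Finset.mul_sum]
    refine Finset.sum_congr rfl fun i hi => ?_
    rw [hoff k i (Finset.ne_of_mem_erase hi).symm, hconj]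
    ring
  rw [key] at hsplit
  rw [hnorm] at hsplit2
  rw [hrest, eq_sub_of_add_eq' hsplit2] at hsplit
  apply mul_left_cancel₀ hk
  have h1 : (1 / (n : ℂ)) * n = 1 := by field_simp
  linear_combination (-1 : ℂ) * hsplit + cip (a k) (b k) * h1
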